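/- Let c = (c₁,c₂) ∈ ℂ², let I = (α₁,α₂) and J = (β₁,β₂) be pairs of nonnegative integers, let a, b ∈ ℂ be not both zero, and let m₁, m₂, n₁, n₂ be positive integers with n₁ ≥ 2, n₂ ≥ 2, m₁(n₁ − 1) > n₁ and m₂(n₂ − 1) > n₂. Then there is no pair (f₁,f₂) of transcendental entire functions of finite order on ℂ² satisfying, for all z ∈ ℂ², (a·∂^I f₁(z) + b·∂^J f₁(z))^{n₁} + f₂(z+c)^{m₁} = 1 and (a·∂^I f₂(z) + b·∂^J f₂(z))^{n₂} + f₁(z+c)^{m₂} = 1. -/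

import Mathlib

/-- A function on ℂ² is entire if it is holomorphic everywhere. -/
def Entire2 (f : ℂ × ℂ → ℂ) : Prop := Differentiable ℂ f

/-- A function on ℂ² is transcendental if it is not a polynomial function. -/
def Transcendental2 (f : ℂ × ℂ → ℂ) : Prop :=
  ¬ ∃ p : MvPolynomial (Fin 2) ℂ, ∀ z : ℂ × ℂ, f z = MvPolynomial.eval ![z.1, z.2] p

/-- A function on ℂ² is of finite order if |f(z)| ≤ exp(‖z‖^ρ) for all large ‖z‖. -/
def FiniteOrder2 (f : ℂ × ℂ → ℂ) : Prop :=
  ∃ ρ > (0 : ℝ), ∃ R > (0 : ℝ), ∀ z : ℂ × ℂ, R ≤ ‖z‖ → ‖f z‖ ≤ Real.exp (‖z‖ ^ ρ)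

/-- Partial derivative with respect to the first variable. -/
noncomputable def pd1 (f : ℂ × ℂ → ℂ) : ℂ × ℂ → ℂ := fun z => fderiv ℂ f z (1, 0)

/-- Partial derivative with respect to the second variable. -/
noncomputable def pd2 (f : ℂ × ℂ → ℂ) : ℂ × ℂ → ℂ := fun z => fderiv ℂ f z (0, 1)

/-- Iterated partial derivative `∂^{α₁+α₂} f / ∂z₁^{α₁} ∂z₂^{α₂}`. -/
noncomputable def partialI (α₁ α₂ : ℕ) (f : ℂ × ℂ → ℂ) : ℂ × ℂ → ℂ :=
  pd1^[α₁] (pd2^[α₂] f)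

section

open Complex Metric Set Filter Topology Asymptotics

theorem exists_norm_fderiv_le_of_differentiable {E : Type*} [NormedAddCommGroup E] [NormedSpace ℂ E]
    [ProperSpace E] {f : E → ℂ} (hf : Differentiable ℂ f) (z : E) (R : ℝ) :
    ∃ M, ∀ x ∈ closedBall z R, ‖fderiv ℂ f x‖ ≤ M := by
  obtain ⟨M, hM⟩ := (isCompact_closedBall z (R + 1)).exists_bound_of_continuousOn
    hf.continuous.continuousOn
  refine ⟨max M 0, fun x hx => ContinuousLinearMap.opNorm_le_bound _ (le_max_right _ _) fun v => ?_⟩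
  rcases eq_or_ne v 0 with rfl | hv
  · simp
  have hv' : 0 < ‖v‖ := norm_pos_iff.2 hv
  have hd : Differentiable ℂ (fun t : ℂ => f (x + t • v)) := by fun_prop
  have hderiv : deriv (fun t : ℂ => f (x + t • v)) 0 = fderiv ℂ f x v := by
    have h1 : HasDerivAt (fun t : ℂ => x + t • v) v 0 := by
      simpa using ((hasDerivAt_id (0 : ℂ)).smul_const v).const_add x
    have h2 : HasFDerivAt f (fderiv ℂ f x) (x + (0 : ℂ) • v) := by
      simpa using (hf x).hasFDerivAt
    exact (h2.comp_hasDerivAt (0 : ℂ) h1).deriv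
  rw [← hderiv]
  have := norm_deriv_le_of_forall_mem_sphere_norm_le (C := max M 0) (inv_pos.2 hv')
    hd.diffContOnCl (c := 0) ?_
  · simpa using this
  · intro t ht
    refine (hM _ ?_).trans (le_max_left _ _)
    have ht' : ‖t‖ = ‖v‖⁻¹ := by simpa using ht
    have : ‖t • v‖ = 1 := by rw [norm_smul, ht', inv_mul_cancel₀ hv'.ne']
    rw [mem_closedBall, dist_eq_norm] at hx ⊢
    calc ‖x + t • v - z‖ = ‖(x - z) + t • v‖ := by congr 1; abel
      _ ≤ R + 1 := (norm_add_le _ _).trans (by linarith)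

theorem fderiv_apply_eq_circleIntegral {E : Type*} [NormedAddCommGroup E]
    [NormedSpace ℂ E] {f : E → ℂ} (hf : Differentiable ℂ f) (v x : E) :
    fderiv ℂ f x v = (2 * Real.pi * I : ℂ)⁻¹ • ∮ t in C(0, 1), ((t - 0) ^ 2)⁻¹ • f (x + t • v) := by
  have hd : Differentiable ℂ (fun t : ℂ => f (x + t • v)) := by fun_prop
  have h1 : HasDerivAt (fun t : ℂ => x + t • v) v 0 := by
    simpa using ((hasDerivAt_id (0 : ℂ)).smul_const v).const_add x
  have h2 : HasFDerivAt f (fderiv ℂ f x) (x + (0 : ℂ) • v) := by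
    simpa using (hf x).hasFDerivAt
  rw [← (h2.comp_hasDerivAt (0 : ℂ) h1).deriv]
  exact (two_pi_I_inv_smul_circleIntegral_sub_sq_inv_smul_of_differentiable isOpen_univ
    (subset_univ _) hd.differentiableOn (mem_ball_self one_pos)).symm

theorem differentiable_fderiv_apply {E : Type*} [NormedAddCommGroup E] [NormedSpace ℂ E]
    [ProperSpace E] {f : E → ℂ} (hf : Differentiable ℂ f) (v : E) :
    Differentiable ℂ (fun x => fderiv ℂ f x v) := by
  simp_rw [fderiv_apply_eq_circleIntegral hf v]
  have main : Differentiable ℂ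
      fun x => ∮ t in C(0, 1), ((t - 0) ^ 2)⁻¹ • f (x + t • v) := by
    intro z
    obtain ⟨M, hM⟩ := exists_norm_fderiv_le_of_differentiable hf z (1 + ‖v‖)
    have : FiniteDimensional ℂ E := FiniteDimensional.of_locallyCompactSpace ℂ
    have : ProperSpace (E →L[ℂ] ℂ) := FiniteDimensional.proper ℂ _
    borelize E
    unfold circleIntegral
    have hfc := hf.continuous
    have hg : ∀ x, Continuous fun θ : ℝ => deriv (circleMap 0 1) θ •
        ((circleMap 0 1 θ - 0) ^ 2)⁻¹ • f (x + circleMap 0 1 θ • v) := by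
      intro x
      have hne : ∀ θ : ℝ, (circleMap 0 1 θ - 0) ^ 2 ≠ 0 := fun θ => by
        simp
      simp only [deriv_circleMap]
      have : Continuous (circleMap 0 1) := continuous_circleMap 0 1
      exact ((this.mul continuous_const)).smul
        ((((this.sub continuous_const).pow 2).inv₀ hne).smul (by fun_prop))
    refine (intervalIntegral.hasFDerivAt_integral_of_dominated_of_fderiv_le
      (F' := fun x θ => deriv (circleMap 0 1) θ • ((circleMap 0 1 θ - 0) ^ 2)⁻¹ •
        fderiv ℂ f (x + circleMap 0 1 θ • v)) (bound := fun _ => M)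
      (ball_mem_nhds z one_pos) (.of_forall fun x => (hg x).aestronglyMeasurable)
      ((hg z).intervalIntegrable _ _) ?_ ?_ intervalIntegrable_const ?_).differentiableAt
    · have hm : Measurable fun θ : ℝ => fderiv ℂ f (z + circleMap 0 1 θ • v) :=
        (measurable_fderiv ℂ f).comp (Continuous.measurable (by
          have : Continuous (circleMap 0 1) := continuous_circleMap 0 1
          fun_prop))
      have : Measurable (circleMap 0 1) := (continuous_circleMap 0 1).measurable
      simp only [deriv_circleMap]
      exact (((this.mul_const I).smul (((this.sub_const 0).pow_const 2).inv.smul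
        hm))).aestronglyMeasurable
    · refine .of_forall fun θ _ x hx => ?_
      simp only [deriv_circleMap, norm_smul, norm_mul, norm_inv, norm_pow, sub_zero]
      simp only [norm_circleMap_zero, abs_one, norm_I]
      norm_num
      refine hM _ ?_
      rw [mem_ball, dist_eq_norm] at hx
      rw [mem_closedBall, dist_eq_norm]
      calc ‖x + circleMap 0 1 θ • v - z‖ = ‖(x - z) + circleMap 0 1 θ • v‖ := by congr 1; abel
        _ ≤ 1 + ‖v‖ := (norm_add_le _ _).trans (by
          rw [norm_smul, norm_circleMap_zero]; simp; linarith)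
    · refine .of_forall fun θ _ x _ => ?_
      have : HasFDerivAt (fun y => f (y + circleMap 0 1 θ • v))
          (fderiv ℂ f (x + circleMap 0 1 θ • v)) x :=
        (hasFDerivAt_comp_add_right _).2 (hf _).hasFDerivAt
      exact (this.const_smul ((circleMap 0 1 θ - 0) ^ 2)⁻¹).const_smul (deriv (circleMap 0 1) θ)
  exact main.const_smul (2 * Real.pi * I : ℂ)⁻¹

/-- `W` has at `z` the second-order expansion
`W z + re (a ζ + b ζ²) + κ ‖ζ‖² + o(‖ζ‖²)`, so that its Laplacian at `z` is `4 κ`. -/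
def HasHermitianJet (W : ℂ → ℝ) (z a b : ℂ) (κ : ℝ) : Prop :=
  (fun ζ : ℂ => W (z + ζ) - W z - ((a * ζ + b * ζ ^ 2).re + κ * ‖ζ‖ ^ 2)) =o[𝓝 0]
    fun ζ : ℂ => ‖ζ‖ ^ 2

theorem isLittleO_sub_taylorTwo {χ χ' : ℝ → ℝ} {q x : ℝ}
    (h₁ : ∀ᶠ t in 𝓝 x, HasDerivAt χ (χ' t) t) (h₂ : HasDerivAt χ' q x) :
    (fun t => χ t - χ x - χ' x * (t - x) - q / 2 * (t - x) ^ 2) =o[𝓝 x] fun t => (t - x) ^ 2 := by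
  obtain ⟨δ, hδ, H⟩ := Metric.eventually_nhds_iff_ball.1 h₁
  have hx : x ∈ ball x δ := mem_ball_self hδ
  have hn : 𝓝[ball x δ] x = 𝓝 x := isOpen_ball.nhdsWithin_eq hx
  have := (convex_ball x δ).isLittleO_pow_succ_real (n := 1) hx
    (f := fun t => χ t - χ' x * (t - x) - q / 2 * (t - x) ^ 2)
    (f' := fun t => χ' t - χ' x - (t - x) * q) (fun t ht => ?_) ?_
  · rw [hn] at this
    refine this.congr_left fun t => ?_
    simp only [sub_self]
    ring
  · have h3 : HasDerivAt (fun t : ℝ => t - x) 1 t := (hasDerivAt_id t).sub_const x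
    refine HasDerivAt.hasDerivWithinAt ?_
    refine (((H t ht).sub (h3.const_mul (χ' x))).sub ((h3.pow 2).const_mul (q / 2))).congr_deriv ?_
    ring
  · rw [hn]
    simpa using h₂.isLittleO

namespace HasHermitianJet

variable {W V : ℂ → ℝ} {z a b a' b' : ℂ} {κ κ' : ℝ}

theorem add (h : HasHermitianJet W z a b κ) (h' : HasHermitianJet V z a' b' κ') :
    HasHermitianJet (fun w => W w + V w) z (a + a') (b + b') (κ + κ') := by
  refine (IsLittleO.add h h').congr_left fun ζ => ?_
  simp only [add_mul, add_re]
  ring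

theorem congr (h : HasHermitianJet W z a b κ) (hWV : W =ᶠ[𝓝 z] V) :
    HasHermitianJet V z a b κ := by
  refine IsLittleO.congr' h ?_ .rfl
  have ht : Tendsto (fun ζ : ℂ => z + ζ) (𝓝 0) (𝓝 z) := by
    have : Continuous (fun ζ : ℂ => z + ζ) := by fun_prop
    simpa using this.tendsto 0
  filter_upwards [ht.eventually hWV] with ζ hζ
  rw [hζ, hWV.self_of_nhds]

theorem nonpos_of_isLocalMax (h : HasHermitianJet W z a b κ) (hW : IsLocalMax W z) : κ ≤ 0 := by
  by_contra! hκ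
  have ht : Tendsto (fun ζ : ℂ => z + ζ) (𝓝 0) (𝓝 z) := by
    have : Continuous (fun ζ : ℂ => z + ζ) := by fun_prop
    simpa using this.tendsto 0
  have h1 := (ht.eventually hW).and (h.def (half_pos hκ))
  obtain ⟨δ, hδ, H⟩ := Metric.eventually_nhds_iff_ball.1 h1
  set t : ℝ := δ / 2 with ht
  have htpos : 0 < t := half_pos hδ
  have key : ∀ u : ℂ, ‖u‖ = 1 → (a * (t * u) + b * (t * u) ^ 2).re + κ * t ^ 2 ≤ κ / 2 * t ^ 2 := by
    intro u hu
    have hn : ‖(t : ℂ) * u‖ = t := by simp [hu, abs_of_pos htpos]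
    obtain ⟨h2, h3⟩ := H (t * u) (by rw [mem_ball_zero_iff, hn]; linarith)
    rw [hn, Real.norm_eq_abs, Real.norm_eq_abs, abs_of_nonneg (sq_nonneg t)] at h3
    have := (abs_le.1 h3).1
    linarith
  have k1 := key 1 (by simp)
  have k2 := key (-1) (by simp)
  have k3 := key I (by simp)
  have k4 := key (-I) (by simp)
  have e : (a * (t * 1) + b * (t * 1) ^ 2) + (a * (t * (-1)) + b * (t * (-1)) ^ 2)
    + (a * (t * I) + b * (t * I) ^ 2) + (a * (t * (-I)) + b * (t * (-I)) ^ 2) = 0 := by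
    linear_combination (2 * b * t ^ 2) * I_sq
  have e' := congrArg re e
  have : 0 < κ * t ^ 2 := by positivity
  simp only [add_re, zero_re] at e' k1 k2 k3 k4
  linarith

theorem isBigO_sub_re (h : HasHermitianJet W z a b κ) :
    (fun ζ : ℂ => W (z + ζ) - W z - (a * ζ).re) =O[𝓝 0] fun ζ : ℂ => ‖ζ‖ ^ 2 := by
  have h1 : (fun ζ : ℂ => (b * ζ ^ 2).re + κ * ‖ζ‖ ^ 2) =O[𝓝 0] fun ζ : ℂ => ‖ζ‖ ^ 2 := by
    refine IsBigO.of_bound (‖b‖ + |κ|) (.of_forall fun ζ => ?_)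
    have h2 := abs_re_le_norm (b * ζ ^ 2)
    have h3 := abs_add_le (b * ζ ^ 2).re (κ * ‖ζ‖ ^ 2)
    rw [abs_mul, abs_of_nonneg (sq_nonneg ‖ζ‖)] at h3
    rw [norm_mul, norm_pow] at h2
    rw [Real.norm_eq_abs, Real.norm_eq_abs, abs_of_nonneg (sq_nonneg ‖ζ‖)]
    linarith
  refine (h.isBigO.add h1).congr_left fun ζ => ?_
  rw [add_re]
  ring

theorem isBigO_re_mul (a : ℂ) : (fun ζ : ℂ => (a * ζ).re) =O[𝓝 0] fun ζ : ℂ => ‖ζ‖ := by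
  refine IsBigO.of_bound ‖a‖ (.of_forall fun ζ => ?_)
  simpa using abs_re_le_norm (a * ζ)

theorem isBigO_sub (h : HasHermitianJet W z a b κ) :
    (fun ζ : ℂ => W (z + ζ) - W z) =O[𝓝 0] fun ζ : ℂ => ‖ζ‖ := by
  have h1 : (fun ζ : ℂ => ‖ζ‖ ^ 2) =O[𝓝 0] fun ζ : ℂ => ‖ζ‖ :=
    (isLittleO_norm_pow_id one_lt_two).isBigO.norm_right
  refine ((h.isBigO_sub_re.trans h1).add (isBigO_re_mul a)).congr_left fun ζ => ?_
  ring

theorem isLittleO_sub_sq (h : HasHermitianJet W z a b κ) :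
    (fun ζ : ℂ => (W (z + ζ) - W z) ^ 2 - (a * ζ).re ^ 2) =o[𝓝 0] fun ζ : ℂ => ‖ζ‖ ^ 2 := by
  have h1 : (fun ζ : ℂ => ‖ζ‖ ^ 2 * ‖ζ‖) =o[𝓝 0] fun ζ : ℂ => ‖ζ‖ ^ 2 := by
    have : (fun ζ : ℂ => ‖ζ‖) =o[𝓝 0] fun _ : ℂ => (1 : ℝ) :=
      (isLittleO_one_iff ℝ).2 (by simpa using (continuous_norm (E := ℂ)).tendsto 0)
    simpa using (isBigO_refl (fun ζ : ℂ => ‖ζ‖ ^ 2) (𝓝 0)).mul_isLittleO this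
  refine ((h.isBigO_sub_re.mul (h.isBigO_sub.add (isBigO_re_mul a))).trans_isLittleO
    h1).congr_left fun ζ => ?_
  ring

theorem comp (h : HasHermitianJet W z a b κ) {χ χ' : ℝ → ℝ} {q : ℝ}
    (h₁ : ∀ᶠ t in 𝓝 (W z), HasDerivAt χ (χ' t) t) (h₂ : HasDerivAt χ' q (W z)) :
    HasHermitianJet (fun w => χ (W w)) z (χ' (W z) * a) (χ' (W z) * b + q * a ^ 2 / 4)
      (χ' (W z) * κ + q * ‖a‖ ^ 2 / 4) := by
  have hT := isLittleO_sub_taylorTwo h₁ h₂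
  have hc : Tendsto (fun ζ : ℂ => W (z + ζ)) (𝓝 0) (𝓝 (W z)) := by
    have h3 : Tendsto (fun ζ : ℂ => W (z + ζ) - W z) (𝓝 0) (𝓝 0) :=
      h.isBigO_sub.trans_tendsto (by simpa using (continuous_norm (E := ℂ)).tendsto 0)
    simpa using h3.add_const (W z)
  have h4 := (hT.comp_tendsto hc).trans_isBigO (h.isBigO_sub.pow 2)
  refine ((h4.add (IsLittleO.const_mul_left h (χ' (W z)))).add
    (h.isLittleO_sub_sq.const_mul_left (q / 2))).congr_left fun ζ => ?_
  have h5 : (a * ζ).re ^ 2 = ‖a‖ ^ 2 * ‖ζ‖ ^ 2 / 2 + (a ^ 2 * ζ ^ 2).re / 2 := by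
    rw [← normSq_eq_norm_sq, ← normSq_eq_norm_sq]
    simp only [normSq_apply, pow_two, mul_re, mul_im]
    ring
  have h6 : ((χ' (W z) * a * ζ + (χ' (W z) * b + q * a ^ 2 / 4) * ζ ^ 2 : ℂ)).re =
      χ' (W z) * (a * ζ + b * ζ ^ 2).re + q / 4 * (a ^ 2 * ζ ^ 2).re := by
    rw [← re_ofReal_mul, ← re_ofReal_mul, ← add_re]
    congr 1
    push_cast
    ring
  simp only [Function.comp_apply]
  rw [h6, h5]
  ring
end HasHermitianJet

theorem AnalyticAt.isLittleO_sub_quadratic {f : ℂ → ℂ} {z : ℂ} (hf : AnalyticAt ℂ f z) :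
    ∃ b : ℂ, (fun ζ : ℂ => f (z + ζ) - f z - (deriv f z * ζ + b * ζ ^ 2)) =o[𝓝 0]
      fun ζ : ℂ => ‖ζ‖ ^ 2 := by
  obtain ⟨p, hp⟩ := hf
  refine ⟨p.coeff 2, ?_⟩
  have := hp.isBigO_sub_partialSum_pow 3
  refine (this.trans_isLittleO ?_).congr_left fun ζ => ?_
  · simp_rw [← norm_pow]
    exact (isLittleO_pow_pow (by norm_num : 2 < 3)).norm_norm
  · rw [hp.deriv]
    simp [FormalMultilinearSeries.partialSum, Finset.sum_range_succ]
    have h0 : p.coeff 0 = f z := hp.coeff_zero _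
    rw [h0]
    ring

theorem AnalyticAt.hasHermitianJet_re {f : ℂ → ℂ} {z : ℂ} (hf : AnalyticAt ℂ f z) :
    ∃ b : ℂ, HasHermitianJet (fun w => (f w).re) z (deriv f z) b 0 := by
  obtain ⟨b, hb⟩ := hf.isLittleO_sub_quadratic
  refine ⟨b, IsBigO.trans_isLittleO (isBigO_of_le _ fun ζ => ?_) hb⟩
  have := abs_re_le_norm (f (z + ζ) - f z - (deriv f z * ζ + b * ζ ^ 2))
  simpa using this

theorem AnalyticAt.hasHermitianJet_log_norm {f : ℂ → ℂ} {z : ℂ} (hf : AnalyticAt ℂ f z)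
    (h0 : f z ≠ 0) : ∃ a b : ℂ, HasHermitianJet (fun w => Real.log ‖f w‖) z a b 0 := by
  have h1 : AnalyticAt ℂ (fun w => Complex.log (f w / f z)) z :=
    (hf.div analyticAt_const h0).clog (by simp [h0])
  obtain ⟨b, hb⟩ := h1.hasHermitianJet_re
  refine ⟨deriv (fun w => Complex.log (f w / f z)) z, b, ?_⟩
  have h2 : ∀ᶠ w in 𝓝 z, f w ≠ 0 := hf.continuousAt.eventually_ne h0
  have h3 : (fun w => (Complex.log (f w / f z)).re + Real.log ‖f z‖) =ᶠ[𝓝 z]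
      fun w => Real.log ‖f w‖ := by
    filter_upwards [h2] with w hw
    rw [log_re, norm_div, Real.log_div (by simpa using hw) (by simpa using h0)]
    ring
  refine HasHermitianJet.congr ?_ h3
  refine IsLittleO.congr_left hb fun ζ => ?_
  ring

theorem AnalyticAt.hasHermitianJet_norm_sq {f : ℂ → ℂ} {z : ℂ} (hf : AnalyticAt ℂ f z) :
    ∃ b : ℂ, HasHermitianJet (fun w => ‖f w‖ ^ 2) z (2 * (starRingEnd ℂ (f z)) * deriv f z) b
      (‖deriv f z‖ ^ 2) := by
  obtain ⟨b₁, h₁⟩ := hf.hasHermitianJet_re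
  have hf' : AnalyticAt ℂ (fun w => -I * f w) z := analyticAt_const.mul hf
  obtain ⟨b₂, h₂⟩ := hf'.hasHermitianJet_re
  have hs : ∀ x : ℝ, HasDerivAt (fun t : ℝ => t ^ 2) (2 * x) x := fun x => by
    simpa using hasDerivAt_pow 2 x
  have hs' : ∀ x : ℝ, HasDerivAt (fun t : ℝ => 2 * t) 2 x := fun x => by
    simpa using (hasDerivAt_id x).const_mul 2
  have h := (h₁.comp (.of_forall hs) (hs' _)).add (h₂.comp (.of_forall hs) (hs' _))
  rw [deriv_const_mul _ hf.differentiableAt] at h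
  have e : (fun w => (f w).re ^ 2 + (-I * f w).re ^ 2) = fun w => ‖f w‖ ^ 2 := by
    ext w
    rw [← normSq_eq_norm_sq, normSq_apply]
    simp
    ring
  rw [e] at h
  refine ⟨↑(2 * (f z).re) * b₁ + ↑2 * deriv f z ^ 2 / 4 +
    (↑(2 * (-I * f z).re) * b₂ + ↑2 * (-I * deriv f z) ^ 2 / 4), ?_⟩
  convert h using 1
  · apply Complex.ext <;> simp
  · rfl
  · simp
    ring

theorem hasDerivAt_log_add_rpow (s : ℝ) {t : ℝ} (ht : -1 < t) :
    HasDerivAt (fun t : ℝ => Real.log (1 + t) + (1 + t) ^ (-s))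
      ((1 + t)⁻¹ - s * (1 + t) ^ (-s - 1)) t := by
  have h0 : 1 + t ≠ 0 := by linarith
  have h1 : HasDerivAt (fun t : ℝ => 1 + t) 1 t := (hasDerivAt_id t).const_add 1
  refine ((h1.log h0).add (h1.rpow_const (p := -s) (Or.inl h0))).congr_deriv ?_
  rw [one_div]
  ring

theorem hasDerivAt_inv_sub_rpow (s : ℝ) {t : ℝ} (ht : -1 < t) :
    HasDerivAt (fun t : ℝ => (1 + t)⁻¹ - s * (1 + t) ^ (-s - 1))
      (-(1 + t)⁻¹ ^ 2 + s * (s + 1) * (1 + t) ^ (-s - 2)) t := by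
  have h0 : 1 + t ≠ 0 := by linarith
  have h1 : HasDerivAt (fun t : ℝ => 1 + t) 1 t := (hasDerivAt_id t).const_add 1
  refine ((h1.inv h0).sub ((h1.rpow_const (p := -s - 1) (Or.inl h0)).const_mul s)).congr_deriv ?_
  rw [show -s - 1 - 1 = -s - 2 by ring]
  field_simp
  ring

theorem exists_hasHermitianJet_log_add_rpow {f : ℂ → ℂ} {z : ℂ} (hf : AnalyticAt ℂ f z) {s ε : ℝ}
    (hs : 0 < s) (hs' : s ≤ 1 / 2) (hε : 0 < ε) :
    ∃ (a b : ℂ) (κ : ℝ),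
      HasHermitianJet (fun w => ε * (Real.log (1 + ‖f w‖ ^ 2) + (1 + ‖f w‖ ^ 2) ^ (-s))) z a b κ ∧
      ε * s ^ 2 * ((1 + ‖f z‖ ^ 2) ^ (-s - 1) * ‖deriv f z‖ ^ 2) ≤ κ := by
  obtain ⟨b, hb⟩ := hf.hasHermitianJet_norm_sq
  set t : ℝ := ‖f z‖ ^ 2 with ht
  have ht0 : 0 ≤ t := sq_nonneg _
  have hpos : 0 < 1 + t := by linarith
  have ht1 : -1 < t := by linarith
  refine ⟨_, _, _, hb.comp (χ := fun t => ε * (Real.log (1 + t) + (1 + t) ^ (-s)))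
    (χ' := fun t => ε * ((1 + t)⁻¹ - s * (1 + t) ^ (-s - 1)))
    (q := ε * (-(1 + t)⁻¹ ^ 2 + s * (s + 1) * (1 + t) ^ (-s - 2)))
    ?_ ((hasDerivAt_inv_sub_rpow s ht1).const_mul ε), ?_⟩
  · filter_upwards [lt_mem_nhds ht1] with u hu using (hasDerivAt_log_add_rpow s hu).const_mul ε
  · have hn : ‖2 * (starRingEnd ℂ) (f z) * deriv f z‖ ^ 2 / 4 = t * ‖deriv f z‖ ^ 2 := by
      simp only [norm_mul, RCLike.norm_conj, mul_pow, ht]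
      norm_num
      ring
    rw [mul_div_assoc, hn, ← ht]
    have e1 : (1 + t) ^ (-s - 1) = (1 + t) ^ (-s) * (1 + t)⁻¹ := by
      rw [Real.rpow_sub_one hpos.ne', div_eq_mul_inv]
    have e2 : (1 + t) ^ (-s - 2) = (1 + t) ^ (-s) * (1 + t)⁻¹ ^ 2 := by
      rw [show -s - 2 = -s - 1 - 1 by ring, Real.rpow_sub_one hpos.ne', e1]
      field_simp
    have hy0 : 0 < (1 + t)⁻¹ := inv_pos.2 hpos
    have hx1 : (1 + t) ^ (-s) ≤ 1 :=
      Real.rpow_le_one_of_one_le_of_nonpos (by linarith) (by linarith)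
    have hx0 : 0 < (1 + t) ^ (-s) := Real.rpow_pos_of_pos hpos _
    rw [e1, e2]
    set x := (1 + t) ^ (-s)
    have ety : t = ((1 + t)⁻¹)⁻¹ - 1 := by rw [inv_inv]; ring
    set y := (1 + t)⁻¹
    have h1 : t * y ^ 2 = y - y ^ 2 := by
      rw [ety]
      field_simp
    have h2 : s * (s + 1) * x ≤ 1 := mul_le_one₀ (by nlinarith) hx0.le hx1
    have h3 : s ^ 2 * (x * y) ≤ (y - s * (x * y)) + (-(y ^ 2) + s * (s + 1) * (x * y ^ 2)) * t := by
      have : (-(y ^ 2) + s * (s + 1) * (x * y ^ 2)) * t = (s * (s + 1) * x - 1) * (t * y ^ 2) := by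
        ring
      rw [this, h1]
      nlinarith [mul_nonneg (sub_nonneg.2 h2) (sq_nonneg y)]
    have h4 := mul_le_mul_of_nonneg_left h3 (mul_nonneg hε.le (sq_nonneg ‖deriv f z‖))
    linarith

theorem exists_hasHermitianJet_log_sq_sub {R : ℝ} {z₀ z : ℂ} (hz : ‖z - z₀‖ ^ 2 < R ^ 2) :
    ∃ a b : ℂ, HasHermitianJet (fun w => Real.log (R ^ 2 - ‖w - z₀‖ ^ 2)) z a b
      (-(R ^ 2 / (R ^ 2 - ‖z - z₀‖ ^ 2) ^ 2)) := by
  have hf : AnalyticAt ℂ (fun w => w - z₀) z := by fun_prop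
  obtain ⟨b, hb⟩ := hf.hasHermitianJet_norm_sq
  set t : ℝ := ‖z - z₀‖ ^ 2 with ht
  have hd : deriv (fun w => w - z₀) z = 1 := by simp
  have h1 : ∀ u : ℝ, HasDerivAt (fun u : ℝ => R ^ 2 - u) (-1) u := fun u =>
    (hasDerivAt_id u).const_sub _
  have h0 : R ^ 2 - t ≠ 0 := by linarith
  have h2 := hb.comp (χ := fun u => Real.log (R ^ 2 - u)) (χ' := fun u => -1 / (R ^ 2 - u))
    (q := -1 / (R ^ 2 - t) ^ 2) ?_ ?_
  · have e : ‖2 * (starRingEnd ℂ) (z - z₀) * 1‖ ^ 2 / 4 = t := by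
      simp only [norm_mul, RCLike.norm_conj, mul_pow, ht]
      norm_num
    rw [hd, ← ht, mul_div_assoc (-1 / (R ^ 2 - t) ^ 2 : ℝ), e] at h2
    have e' : -1 / (R ^ 2 - t) * ‖(1 : ℂ)‖ ^ 2 + -1 / (R ^ 2 - t) ^ 2 * t =
        -(R ^ 2 / (R ^ 2 - t) ^ 2) := by
      rw [norm_one]
      field_simp
      ring
    rw [e'] at h2
    exact ⟨_, _, h2⟩
  · filter_upwards [gt_mem_nhds hz] with u hu
    exact (h1 u).log (by linarith)
  · refine ((hasDerivAt_const t (-1 : ℝ)).div (h1 t) h0).congr_deriv ?_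
    simp

theorem eq_zero_of_curvature_le {F G h : ℂ → ℂ} (hF : Differentiable ℂ F)
    (hG : Differentiable ℂ G) (hh : Differentiable ℂ h) {s ε c : ℝ} (hs : 0 < s) (hs' : s ≤ 1 / 2)
    (hε : 0 < ε) (hc : 0 < c)
    (H : ∀ z, c * ‖h z‖ ^ 2 * ((1 + ‖F z‖ ^ 2) * (1 + ‖G z‖ ^ 2)) ^ (2 * ε) ≤
      (1 + ‖G z‖ ^ 2) ^ (-s - 1) * ‖deriv G z‖ ^ 2 + (1 + ‖F z‖ ^ 2) ^ (-s - 1) * ‖deriv F z‖ ^ 2)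
    (z₀ : ℂ) : h z₀ = 0 := by
  by_contra h0
  set χ : ℝ → ℝ := fun t => ε * (Real.log (1 + t) + (1 + t) ^ (-s)) with hχ
  have hχ0 : ∀ t, 0 ≤ t → 0 ≤ χ t := fun t ht =>
    mul_nonneg hε.le (add_nonneg (Real.log_nonneg (by linarith)) (Real.rpow_nonneg (by linarith) _))
  have hχle : ∀ t, 0 ≤ t → Real.exp (χ t) ≤ Real.exp ε * (1 + t) ^ ε := fun t ht => by
    rw [Real.rpow_def_of_pos (by linarith), ← Real.exp_add, Real.exp_le_exp, hχ]
    have : (1 + t) ^ (-s) ≤ 1 := Real.rpow_le_one_of_one_le_of_nonpos (by linarith) (by linarith)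
    nlinarith
  have hχc : ∀ f : ℂ → ℂ, Continuous f → Continuous fun z => χ (‖f z‖ ^ 2) := fun f hf => by
    have hp : ∀ z, 1 + ‖f z‖ ^ 2 ≠ 0 := fun z => by positivity
    have : Continuous fun z => 1 + ‖f z‖ ^ 2 := by fun_prop
    exact continuous_const.mul ((this.log hp).add (this.rpow_const fun z => Or.inl (hp z)))
  have bound : ∀ R : ℝ, 0 < R →
      ‖h z₀‖ * R ^ 2 ≤ Real.exp (2 * ε) * Real.sqrt (1 / (ε * s ^ 2 * c)) * R := by
    intro R hR
    set U : ℂ → ℝ := fun z => ‖h z‖ * Real.exp (χ (‖F z‖ ^ 2)) * Real.exp (χ (‖G z‖ ^ 2)) *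
      (R ^ 2 - ‖z - z₀‖ ^ 2) with hU
    have hUc : Continuous U := by
      have h1 := hχc F hF.continuous
      have h2 := hχc G hG.continuous
      exact ((hh.continuous.norm.mul (Real.continuous_exp.comp h1)).mul
        (Real.continuous_exp.comp h2)).mul (by fun_prop)
    obtain ⟨z, hz, hmax⟩ := (isCompact_closedBall z₀ R).exists_isMaxOn
      ⟨z₀, mem_closedBall_self hR.le⟩ hUc.continuousOn
    have hU0 : ‖h z₀‖ * R ^ 2 ≤ U z₀ := by
      have e1 := Real.one_le_exp (hχ0 (‖F z₀‖ ^ 2) (sq_nonneg _))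
      have e2 := Real.one_le_exp (hχ0 (‖G z₀‖ ^ 2) (sq_nonneg _))
      simp only [hU, sub_self, norm_zero]
      have : ‖h z₀‖ * R ^ 2 * 1 ≤ ‖h z₀‖ * R ^ 2 *
          (Real.exp (χ (‖F z₀‖ ^ 2)) * Real.exp (χ (‖G z₀‖ ^ 2))) :=
        mul_le_mul_of_nonneg_left (one_le_mul_of_one_le_of_one_le e1 e2) (by positivity)
      linarith
    have hle := hmax (mem_closedBall_self hR.le)
    simp only [mem_ofPred_eq] at hle
    have hUpos : 0 < U z :=
      (mul_pos (norm_pos_iff.2 h0) (by positivity)).trans_le (hU0.trans hle)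
    have hlt : ‖z - z₀‖ ^ 2 < R ^ 2 := by
      by_contra! hcon
      exact absurd hUpos (not_lt.2 (mul_nonpos_of_nonneg_of_nonpos (by positivity) (by linarith)))
    have hz0 : h z ≠ 0 := by
      intro hcon
      simp [hU, hcon] at hUpos
    refine (hU0.trans hle).trans ?_
    obtain ⟨aF, bF, κF, jF, hκF⟩ := exists_hasHermitianJet_log_add_rpow (hF.analyticAt z) hs hs' hε
    obtain ⟨aG, bG, κG, jG, hκG⟩ := exists_hasHermitianJet_log_add_rpow (hG.analyticAt z) hs hs' hε
    obtain ⟨ah, bh, jh⟩ := (hh.analyticAt z).hasHermitianJet_log_norm hz0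
    obtain ⟨aR, bR, jR⟩ := exists_hasHermitianJet_log_sq_sub hlt
    have hlocal : IsLocalMax (fun w => Real.log ‖h w‖ + χ (‖F w‖ ^ 2) + χ (‖G w‖ ^ 2) +
        Real.log (R ^ 2 - ‖w - z₀‖ ^ 2)) z := by
      have n1 : ∀ᶠ w in 𝓝 z, h w ≠ 0 := hh.continuous.continuousAt.eventually_ne hz0
      have n2 : ∀ᶠ w in 𝓝 z, ‖w - z₀‖ ^ 2 < R ^ 2 :=
        (by fun_prop : Continuous fun w => ‖w - z₀‖ ^ 2).continuousAt.eventually_lt_const hlt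
      have key : ∀ w, h w ≠ 0 → ‖w - z₀‖ ^ 2 < R ^ 2 → Real.log ‖h w‖ + χ (‖F w‖ ^ 2) +
          χ (‖G w‖ ^ 2) + Real.log (R ^ 2 - ‖w - z₀‖ ^ 2) = Real.log (U w) := by
        intro w hw hw'
        have := norm_ne_zero_iff.2 hw
        have : R ^ 2 - ‖w - z₀‖ ^ 2 ≠ 0 := by linarith
        simp only [hU]
        rw [Real.log_mul (by positivity) this, Real.log_mul (by positivity) (by positivity),
          Real.log_mul (by positivity) (by positivity), Real.log_exp, Real.log_exp]
      filter_upwards [n1, n2] with w hw hw'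
      rw [key w hw hw', key z hz0 hlt]
      refine Real.log_le_log ?_ (hmax ?_)
      · have := norm_pos_iff.2 hw
        have : 0 < R ^ 2 - ‖w - z₀‖ ^ 2 := by linarith
        positivity
      · rw [mem_closedBall, dist_eq_norm]
        exact (lt_of_pow_lt_pow_left₀ 2 hR.le hw').le
    have hκ := (((jh.add jF).add jG).add jR).nonpos_of_isLocalMax hlocal
    have hD : 0 < R ^ 2 - ‖z - z₀‖ ^ 2 := by linarith
    have h1 : ε * s ^ 2 * (c * ‖h z‖ ^ 2 * ((1 + ‖F z‖ ^ 2) * (1 + ‖G z‖ ^ 2)) ^ (2 * ε)) ≤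
        R ^ 2 / (R ^ 2 - ‖z - z₀‖ ^ 2) ^ 2 := by
      have := mul_le_mul_of_nonneg_left (H z) (by positivity : 0 ≤ ε * s ^ 2)
      linarith
    rw [le_div_iff₀ (by positivity)] at h1
    set P := ((1 + ‖F z‖ ^ 2) * (1 + ‖G z‖ ^ 2)) ^ ε with hP
    have hP2 : ((1 + ‖F z‖ ^ 2) * (1 + ‖G z‖ ^ 2)) ^ (2 * ε) = P ^ 2 := by
      rw [two_mul, Real.rpow_add (by positivity), ← hP, ← pow_two]
    rw [hP2] at h1
    have hP0 : 0 < P := by positivity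
    have h2 : (‖h z‖ * P * (R ^ 2 - ‖z - z₀‖ ^ 2)) ≤ Real.sqrt (1 / (ε * s ^ 2 * c)) * R := by
      refine le_of_sq_le_sq ?_ (by positivity)
      rw [mul_pow (Real.sqrt _), Real.sq_sqrt (by positivity), one_div, inv_mul_eq_div,
        le_div_iff₀ (by positivity)]
      linarith
    have h3 : U z ≤ Real.exp (2 * ε) * (‖h z‖ * P * (R ^ 2 - ‖z - z₀‖ ^ 2)) := by
      have e1 := mul_le_mul (hχle (‖F z‖ ^ 2) (sq_nonneg _)) (hχle (‖G z‖ ^ 2) (sq_nonneg _))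
        (by positivity) (by positivity)
      have e2 : Real.exp ε * (1 + ‖F z‖ ^ 2) ^ ε * (Real.exp ε * (1 + ‖G z‖ ^ 2) ^ ε) =
          Real.exp (2 * ε) * P := by
        rw [hP, Real.mul_rpow (by positivity) (by positivity), two_mul, Real.exp_add]
        ring
      rw [e2] at e1
      have := mul_le_mul_of_nonneg_left e1
        (mul_nonneg (norm_nonneg (h z)) hD.le)
      simp only [hU]
      linarith
    have h4 := mul_le_mul_of_nonneg_left h2 (Real.exp_nonneg (2 * ε))
    linarith
  set K := Real.exp (2 * ε) * Real.sqrt (1 / (ε * s ^ 2 * c)) with hK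
  have hK0 : 0 ≤ K := by positivity
  have hn : 0 < ‖h z₀‖ := norm_pos_iff.2 h0
  have := bound ((K + 1) / ‖h z₀‖) (by positivity)
  rw [div_pow, mul_div_assoc', mul_div_assoc', div_le_div_iff₀ (by positivity) hn] at this
  nlinarith [pow_pos hn 2]

theorem one_add_sq_le_of_pow_le {x L : ℝ} (hx : 0 ≤ x) (hL : 1 ≤ L) {n : ℕ} (hn : n ≠ 0)
    (h : x ^ n ≤ L) : 1 + x ^ 2 ≤ 2 * L ^ (2 / n : ℝ) := by
  have h1 : x ^ 2 ≤ L ^ (2 / n : ℝ) := by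
    have e : x ^ 2 = (x ^ n) ^ (2 / n : ℝ) := by
      rw [← Real.rpow_natCast x n, ← Real.rpow_mul hx, mul_div_cancel₀ _ (by positivity)]
      norm_cast
    rw [e]
    exact Real.rpow_le_rpow (by positivity) h (by positivity)
  have h2 : 1 ≤ L ^ (2 / n : ℝ) := Real.one_le_rpow hL (by positivity)
  linarith

theorem rpow_le_mul_pow_of_le_pow {x y L : ℝ} (hx : 0 ≤ x) (hy : 0 ≤ y) (hL : 1 ≤ L) {n m : ℕ}
    (hn : 2 ≤ n) (hm : 2 ≤ m) (hxL : L / 4 ≤ x ^ n) (hyL : y ^ m ≤ L) {s : ℝ} (hs : 0 ≤ s)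
    (hs' : s ≤ 1 - 1 / n - 1 / m) :
    L ^ (1 - 1 / n - 1 / m : ℝ) ≤ 64 * ((1 + y ^ 2) ^ (-s - 1) * x ^ (2 * (n - 1))) := by
  have hn' : (2 : ℝ) ≤ n := by exact_mod_cast hn
  have hm' : (2 : ℝ) ≤ m := by exact_mod_cast hm
  have hL0 : 0 < L := by linarith
  have hninv : (1 / n : ℝ) ≤ 1 / 2 := one_div_le_one_div_of_le (by norm_num) hn'
  have hminv : (1 / m : ℝ) ≤ 1 / 2 := one_div_le_one_div_of_le (by norm_num) hm'
  have hn0 : (0 : ℝ) < 1 / n := by positivity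
  have hm0 : (0 : ℝ) < 1 / m := by positivity
  have h1 : L ^ (2 - 2 / n : ℝ) / 16 ≤ x ^ (2 * (n - 1)) := by
    have e : x ^ (2 * (n - 1)) = (x ^ n) ^ (2 - 2 / n : ℝ) := by
      rw [← Real.rpow_natCast x n, ← Real.rpow_mul hx, ← Real.rpow_natCast]
      congr 1
      rw [Nat.cast_mul, Nat.cast_sub (by omega)]
      field_simp
      push_cast
      ring
    have e2 : (2 - 2 / n : ℝ) = 2 - 2 * (1 / n) := by ring
    rw [e]
    refine le_trans ?_ (Real.rpow_le_rpow (by positivity) hxL (by rw [e2]; linarith))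
    rw [Real.div_rpow hL0.le (by norm_num)]
    refine div_le_div_of_nonneg_left (by positivity) (by positivity) ?_
    calc (4 : ℝ) ^ (2 - 2 / n : ℝ) ≤ 4 ^ (2 : ℝ) :=
          Real.rpow_le_rpow_of_exponent_le (by norm_num) (by rw [e2]; linarith)
      _ = 16 := by norm_num
  have h2 : L ^ (-(2 / m * (s + 1)) : ℝ) / 4 ≤ (1 + y ^ 2) ^ (-s - 1) := by
    have h3 := Real.rpow_le_rpow_of_nonpos (z := -s - 1) (by positivity)
      (one_add_sq_le_of_pow_le hy hL (by omega) hyL) (by linarith)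
    refine le_trans ?_ h3
    rw [Real.mul_rpow (by norm_num) (by positivity), ← Real.rpow_mul hL0.le,
      show (2 / m * (-s - 1) : ℝ) = -(2 / m * (s + 1)) by ring, div_eq_inv_mul]
    refine mul_le_mul_of_nonneg_right ?_ (by positivity)
    calc (4⁻¹ : ℝ) = 2 ^ (-2 : ℝ) := by
          rw [Real.rpow_neg (by norm_num)]; norm_num
      _ ≤ 2 ^ (-s - 1) := Real.rpow_le_rpow_of_exponent_le (by norm_num) (by linarith)
  have h4 := mul_le_mul h2 h1 (by positivity) (by positivity)
  have h5 : L ^ (1 - 1 / n - 1 / m : ℝ) ≤ L ^ (-(2 / m * (s + 1)) : ℝ) * L ^ (2 - 2 / n : ℝ) := by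
    rw [← Real.rpow_add hL0]
    refine Real.rpow_le_rpow_of_exponent_le hL ?_
    have e1 : (-(2 / m * (s + 1)) + (2 - 2 / n) : ℝ) =
      2 * (1 - 1 / n - 1 / m) - 2 * (1 / m) * s := by ring
    rw [e1]
    nlinarith
  linarith

theorem rpow_le_add_of_one_le_add {x y : ℝ} (hx : 0 ≤ x) (hy : 0 ≤ y) {n m : ℕ}
    (hn : 2 ≤ n) (hm : 2 ≤ m) (hxy : 1 ≤ x ^ n + y ^ m) {s ε : ℝ} (hs : 0 ≤ s)
    (hs' : s ≤ 1 - 1 / n - 1 / m) (hε : 0 ≤ ε) (hε' : 4 * ε ≤ 1 - 1 / n - 1 / m) :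
    1 / 256 * ((1 + x ^ 2) * (1 + y ^ 2)) ^ (2 * ε) ≤
      (1 + y ^ 2) ^ (-s - 1) * x ^ (2 * (n - 1)) + (1 + x ^ 2) ^ (-s - 1) * y ^ (2 * (m - 1)) := by
  have hn' : (2 : ℝ) ≤ n := by exact_mod_cast hn
  have hm' : (2 : ℝ) ≤ m := by exact_mod_cast hm
  have hninv : (1 / n : ℝ) ≤ 1 / 2 := one_div_le_one_div_of_le (by norm_num) hn'
  have hminv : (1 / m : ℝ) ≤ 1 / 2 := one_div_le_one_div_of_le (by norm_num) hm'
  have hn0 : (0 : ℝ) < 1 / n := by positivity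
  have hm0 : (0 : ℝ) < 1 / m := by positivity
  obtain ⟨L, hLdef⟩ : ∃ L, L = 1 + x ^ n + y ^ m := ⟨_, rfl⟩
  have hxn : 0 ≤ x ^ n := by positivity
  have hym : 0 ≤ y ^ m := by positivity
  have hL : 1 ≤ L := by linarith
  have hL0 : 0 < L := by linarith
  have h1 : ((1 + x ^ 2) * (1 + y ^ 2)) ^ (2 * ε) ≤ 4 * L ^ (1 - 1 / n - 1 / m : ℝ) := by
    have h2 : (1 + x ^ 2) * (1 + y ^ 2) ≤ 4 * L ^ (2 : ℝ) := by
      have h3 := mul_le_mul (one_add_sq_le_of_pow_le hx hL (n := n) (by omega) (by linarith))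
        (one_add_sq_le_of_pow_le hy hL (n := m) (by omega) (by linarith)) (by positivity)
        (by positivity)
      have h4 : L ^ (2 / n : ℝ) * L ^ (2 / m : ℝ) ≤ L ^ (2 : ℝ) := by
        rw [← Real.rpow_add hL0]
        refine Real.rpow_le_rpow_of_exponent_le hL ?_
        rw [show (2 / n + 2 / m : ℝ) = 2 * (1 / n) + 2 * (1 / m) by ring]
        linarith
      linarith
    refine (Real.rpow_le_rpow (by positivity) h2 (by positivity)).trans ?_
    rw [Real.mul_rpow (by norm_num) (by positivity), ← Real.rpow_mul hL0.le]
    refine mul_le_mul ?_ (Real.rpow_le_rpow_of_exponent_le hL (by linarith)) (by positivity)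
      (by norm_num)
    calc (4 : ℝ) ^ (2 * ε) ≤ 4 ^ (1 : ℝ) :=
          Real.rpow_le_rpow_of_exponent_le (by norm_num) (by linarith)
      _ = 4 := by norm_num
  rcases le_total (y ^ m) (x ^ n) with h | h
  · have h2 := rpow_le_mul_pow_of_le_pow hx hy hL hn hm (by linarith) (by linarith) hs hs'
    have : 0 ≤ (1 + x ^ 2) ^ (-s - 1) * y ^ (2 * (m - 1)) := by positivity
    linarith
  · have h2 := rpow_le_mul_pow_of_le_pow hy hx hL hm hn (by linarith) (by linarith) hs
      (by linarith)
    have : 0 ≤ (1 + y ^ 2) ^ (-s - 1) * x ^ (2 * (n - 1)) := by positivity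
    rw [show (1 - 1 / m - 1 / n : ℝ) = 1 - 1 / n - 1 / m by ring] at h2
    linarith

theorem exists_factor_of_pow_add_pow_eq_one {F G : ℂ → ℂ} (hF : Differentiable ℂ F)
    (hG : Differentiable ℂ G) {n m : ℕ} (hn : 2 ≤ n) (hm : 2 ≤ m)
    (hFG : ∀ z, F z ^ n + G z ^ m = 1) :
    ∃ h : ℂ → ℂ, Differentiable ℂ h ∧ ∀ z, deriv G z = n * h z * F z ^ (n - 1) ∧
      deriv F z = -(m * h z * G z ^ (m - 1)) := by
  have hn0 : (n : ℂ) ≠ 0 := by norm_cast; lia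
  have hm0 : (m : ℂ) ≠ 0 := by norm_cast; lia
  have hF' : Differentiable ℂ (deriv F) := by
    simpa only [fderiv_apply_one_eq_deriv] using differentiable_fderiv_apply hF 1
  have hG' : Differentiable ℂ (deriv G) := by
    simpa only [fderiv_apply_one_eq_deriv] using differentiable_fderiv_apply hG 1
  have key (z : ℂ) : n * F z ^ (n - 1) * deriv F z + m * G z ^ (m - 1) * deriv G z = 0 := by
    have h1 := ((hF z).hasDerivAt.fun_pow n).fun_add ((hG z).hasDerivAt.fun_pow m)
    simp_rw [hFG] at h1
    exact h1.unique (hasDerivAt_const z 1)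
  have hG0 (z : ℂ) (hz : F z = 0) : G z ≠ 0 := by
    intro h0
    have := hFG z
    rw [hz, h0, zero_pow (by lia), zero_pow (by lia)] at this
    norm_num at this
  classical
  set h : ℂ → ℂ := fun z => if F z ≠ 0 then deriv G z / (n * F z ^ (n - 1))
    else -deriv F z / (m * G z ^ (m - 1)) with hdef
  have hspec (z : ℂ) : deriv G z = n * h z * F z ^ (n - 1) ∧
      deriv F z = -(m * h z * G z ^ (m - 1)) := by
    have hk := key z
    by_cases hz : F z = 0
    · have hgz := hG0 z hz
      have hh : h z = -deriv F z / (m * G z ^ (m - 1)) := by simp [hdef, hz]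
      rw [hz, zero_pow (by lia)] at hk ⊢
      refine ⟨?_, by rw [hh]; field_simp⟩
      have h2 : (m : ℂ) * G z ^ (m - 1) ≠ 0 := mul_ne_zero hm0 (pow_ne_zero _ hgz)
      simpa [h2, hm0, hgz] using hk
    · have hh : h z = deriv G z / (n * F z ^ (n - 1)) := by simp [hdef, hz]
      refine ⟨by rw [hh]; field_simp, ?_⟩
      rw [hh]
      field_simp
      linear_combination hk
  refine ⟨h, fun z => ?_, hspec⟩
  by_cases hz : F z = 0
  · have hev : h =ᶠ[𝓝 z] fun w => -deriv F w / (m * G w ^ (m - 1)) := by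
      filter_upwards [hG.continuous.continuousAt.eventually_ne (hG0 z hz)] with w hw
      rw [(hspec w).2]
      field_simp
    refine DifferentiableAt.congr_of_eventuallyEq ?_ hev
    exact (hF' z).neg.div (((hG z).pow _).const_mul _)
      (mul_ne_zero hm0 (pow_ne_zero _ (hG0 z hz)))
  · have hev : h =ᶠ[𝓝 z] fun w => deriv G w / (n * F w ^ (n - 1)) := by
      filter_upwards [hF.continuous.continuousAt.eventually_ne hz] with w hw
      rw [(hspec w).1]
      field_simp
    refine DifferentiableAt.congr_of_eventuallyEq ?_ hev
    exact (hG' z).div (((hF z).pow _).const_mul _) (mul_ne_zero hn0 (pow_ne_zero _ hz))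

theorem deriv_eq_zero_of_pow_add_pow_eq_one {F G : ℂ → ℂ} (hF : Differentiable ℂ F)
    (hG : Differentiable ℂ G) {n m : ℕ} (hn : 2 ≤ n) (hm : 2 ≤ m)
    (hnm : (1 / n + 1 / m : ℝ) < 1) (hFG : ∀ z, F z ^ n + G z ^ m = 1) (z : ℂ) :
    deriv G z = 0 := by
  obtain ⟨h, hh, hspec⟩ := exists_factor_of_pow_add_pow_eq_one hF hG hn hm hFG
  have hη : (1 - 1 / n - 1 / m : ℝ) ≤ 1 := by
    have : (0 : ℝ) ≤ 1 / n := by positivity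
    have : (0 : ℝ) ≤ 1 / m := by positivity
    linarith
  have hsq (k : ℕ) (hk : 2 ≤ k) (u v : ℂ) :
      ‖u‖ ^ 2 * ‖v‖ ^ (2 * (k - 1)) ≤ ‖(k * u * v ^ (k - 1) : ℂ)‖ ^ 2 := by
    have hk1 : (1 : ℝ) ≤ k ^ 2 := by
      have : (1 : ℝ) ≤ k := by norm_cast; lia
      exact one_le_pow₀ this
    rw [norm_mul, norm_mul, norm_pow, norm_natCast, mul_pow, mul_pow, ← pow_mul, mul_comm _ 2]
    have : 0 ≤ ‖u‖ ^ 2 * ‖v‖ ^ (2 * (k - 1)) := by positivity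
    nlinarith
  have hz : h z = 0 := by
    refine eq_zero_of_curvature_le hF hG hh (s := (1 - 1 / n - 1 / m) / 2)
      (ε := (1 - 1 / n - 1 / m) / 4) (c := 1 / 256) (by linarith) (by linarith) (by linarith)
      (by norm_num) (fun w => ?_) z
    have h1 : 1 ≤ ‖F w‖ ^ n + ‖G w‖ ^ m := by
      have := norm_add_le (F w ^ n) (G w ^ m)
      simpa [hFG w] using this
    have h2 := rpow_le_add_of_one_le_add (norm_nonneg (F w)) (norm_nonneg (G w)) hn hm h1
      (s := (1 - 1 / n - 1 / m) / 2) (ε := (1 - 1 / n - 1 / m) / 4) (by linarith) (by linarith)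
      (by linarith) (by linarith)
    have h3 := mul_le_mul_of_nonneg_left h2 (sq_nonneg ‖h w‖)
    rw [(hspec w).1, (hspec w).2, norm_neg]
    have h4 := mul_le_mul_of_nonneg_left (hsq n hn (h w) (F w))
      (by positivity : 0 ≤ (1 + ‖G w‖ ^ 2) ^ (-((1 - 1 / n - 1 / m : ℝ) / 2) - 1))
    have h5 := mul_le_mul_of_nonneg_left (hsq m hm (h w) (G w))
      (by positivity : 0 ≤ (1 + ‖F w‖ ^ 2) ^ (-((1 - 1 / n - 1 / m : ℝ) / 2) - 1))
    linarith
  rw [(hspec z).1, hz]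
  ring

theorem differentiable_iterate {D : (ℂ × ℂ → ℂ) → ℂ × ℂ → ℂ}
    (hD : ∀ f, Differentiable ℂ f → Differentiable ℂ (D f)) (k : ℕ) {f : ℂ × ℂ → ℂ}
    (hf : Differentiable ℂ f) : Differentiable ℂ (D^[k] f) := by
  induction k with
  | zero => exact hf
  | succ k ih => rw [Function.iterate_succ_apply']; exact hD _ ih

theorem differentiable_partialI (i j : ℕ) {f : ℂ × ℂ → ℂ} (hf : Differentiable ℂ f) :
    Differentiable ℂ (partialI i j f) :=
  differentiable_iterate (fun _ h => differentiable_fderiv_apply h (1, 0)) i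
    (differentiable_iterate (fun _ h => differentiable_fderiv_apply h (0, 1)) j hf)

theorem eq_const_of_pow_add_pow_eq_one {F G : ℂ × ℂ → ℂ} (hF : Differentiable ℂ F)
    (hG : Differentiable ℂ G) {n m : ℕ} (hn : 2 ≤ n) (hm : 2 ≤ m)
    (hnm : (1 / n + 1 / m : ℝ) < 1) (hFG : ∀ z, F z ^ n + G z ^ m = 1) (z : ℂ × ℂ) :
    G z = G 0 := by
  have hF' : Differentiable ℂ fun t : ℂ => F (t • z) := by fun_prop
  have hG' : Differentiable ℂ fun t : ℂ => G (t • z) := by fun_prop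
  simpa using is_const_of_deriv_eq_zero hG'
    (deriv_eq_zero_of_pow_add_pow_eq_one hF' hG' hn hm hnm fun t => hFG (t • z)) 1 0

end

theorem stmt_4 (c : ℂ × ℂ) (α₁ α₂ β₁ β₂ : ℕ) (a b : ℂ) (hab : ¬(a = 0 ∧ b = 0))
    (m₁ m₂ n₁ n₂ : ℕ) (hm₁ : 0 < m₁) (hm₂ : 0 < m₂) (hn₁ : 0 < n₁) (hn₂ : 0 < n₂)
    (hn₁2 : 2 ≤ n₁) (hn₂2 : 2 ≤ n₂) (hmn₁ : m₁ * (n₁ - 1) > n₁) (hmn₂ : m₂ * (n₂ - 1) > n₂) :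
    ¬ ∃ f₁ f₂ : ℂ × ℂ → ℂ,
      Entire2 f₁ ∧ Transcendental2 f₁ ∧ FiniteOrder2 f₁ ∧
      Entire2 f₂ ∧ Transcendental2 f₂ ∧ FiniteOrder2 f₂ ∧
      (∀ z : ℂ × ℂ,
        (a * partialI α₁ α₂ f₁ z + b * partialI β₁ β₂ f₁ z) ^ n₁ + f₂ (z + c) ^ m₁ = 1) ∧
      (∀ z : ℂ × ℂ,
        (a * partialI α₁ α₂ f₂ z + b * partialI β₁ β₂ f₂ z) ^ n₂ + f₁ (z + c) ^ m₂ = 1) := by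
  rintro ⟨f₁, f₂, hf₁, -, -, hf₂, hT, -, h, -⟩
  have hm : 2 ≤ m₁ := by
    by_contra! hlt
    interval_cases m₁
    lia
  have hnm : (1 / n₁ + 1 / m₁ : ℝ) < 1 := by
    obtain ⟨k, rfl⟩ : ∃ k, n₁ = k + 1 := ⟨n₁ - 1, by lia⟩
    have h1 : ((k + 1 : ℕ) : ℝ) < m₁ * k := by exact_mod_cast hmn₁
    have hm0 : (0 : ℝ) < m₁ := by exact_mod_cast hm₁
    rw [div_add_div _ _ (by positivity) hm0.ne', div_lt_one (by positivity)]
    push_cast at h1 ⊢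
    linarith
  have hF : Differentiable ℂ fun z => a * partialI α₁ α₂ f₁ z + b * partialI β₁ β₂ f₁ z :=
    ((differentiable_partialI α₁ α₂ hf₁).const_mul a).add
      ((differentiable_partialI β₁ β₂ hf₁).const_mul b)
  have hG : Differentiable ℂ fun z => f₂ (z + c) :=
    Differentiable.comp hf₂ (differentiable_id.add_const c)
  refine hT ⟨MvPolynomial.C (f₂ (0 + c)), fun z => ?_⟩
  simpa using eq_const_of_pow_add_pow_eq_one hF hG hn₁2 hm hnm h (z - c)
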